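/- For u ∈ C^∞(T^3; R^3) define the 3×3-matrix-valued field R u = −(−Δ)^{−1}(∇u + (∇u)^T) − (1/2)(−Δ)^{−2} ∇² (∇·u) + (1/2)(−Δ)^{−1}(∇·u) Id_{3×3}, where the inverse Laplacians are defined on zero-mean functions via Fourier series (all the functions they are applied to here have zero mean on T^3). Then: (i) R u(x) is a symmetric matrix for every x; (ii) R u(x) is trace-free for every x; (iii) div(R u) = u − ⨍_{T^3} u dx. Moreover, for f ∈ C^∞(T^3; R), the vector field R_vex f = ∇Δ^{−1}(f − ⨍_{T^3} f dx) satisfies div(R_vex f) = f − ⨍_{T^3} f dx. -/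

import Mathlib

open MeasureTheory Set Real Filter
open scoped ENNReal NNReal BigOperators

noncomputable section

abbrev V3 := Fin 3 → ℝ

/-- Fundamental domain of the torus `T³ = ℝ³/ℤ³`. -/
def cube3 : Set V3 := Set.univ.pi fun _ => Set.Ico (0:ℝ) 1

/-- The measure on the torus, realized as Lebesgue measure on the fundamental domain. -/
def muT : Measure V3 := volume.restrict cube3

/-- `ℤ³`-periodicity of a function on `ℝ³`. -/
def Per {α : Type*} (f : V3 → α) : Prop :=
  ∀ (x : V3) (k : Fin 3 → ℤ), f (x + (fun i => (k i : ℝ))) = f x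

/-- The partial derivative `∂ᵢ g` at `x`. -/
def pd (g : V3 → ℝ) (i : Fin 3) (x : V3) : ℝ := fderiv ℝ g x (Pi.single i 1)

/-- Divergence of a vector field. -/
def divg (u : V3 → V3) (x : V3) : ℝ := ∑ i, pd (fun y => u y i) i x

/-- Euclidean norm on `ℝ³`. -/
def nE (x : V3) : ℝ := Real.sqrt (∑ i, x i ^ 2)

/-- A Littlewood–Paley pair `(χ, φ̃)`: smooth radial cutoffs with the standard support,
value and partition-of-unity properties. -/
def LPSetup (χ φt : V3 → ℝ) : Prop :=
  ContDiff ℝ (⊤ : ℕ∞) χ ∧ ContDiff ℝ (⊤ : ℕ∞) φt ∧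
  (∀ ξ η : V3, nE ξ = nE η → χ ξ = χ η) ∧ (∀ ξ η : V3, nE ξ = nE η → φt ξ = φt η) ∧
  (∀ ξ, χ ξ ∈ Icc (0:ℝ) 1) ∧ (∀ ξ, φt ξ ∈ Icc (0:ℝ) 1) ∧
  (∀ ξ, 4/3 < nE ξ → χ ξ = 0) ∧ (∀ ξ, nE ξ ≤ 3/4 → χ ξ = 1) ∧
  (∀ ξ, nE ξ < 3/4 ∨ 8/3 < nE ξ → φt ξ = 0) ∧
  (∀ ξ, 6/7 ≤ nE ξ → nE ξ ≤ 12/7 → φt ξ = 1) ∧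
  (∀ ξ, χ ξ + ∑' j : ℕ, φt (((2:ℝ) ^ (-(j:ℤ))) • ξ) = 1)

/-- The character `e^{2πi k·x}`. -/
def eK (k : Fin 3 → ℤ) (x : V3) : ℂ :=
  Complex.exp (2 * (Real.pi : ℂ) * Complex.I * (∑ i, (k i : ℂ) * (x i : ℂ)))

/-- Fourier coefficient of a periodic function. -/
def fc (f : V3 → ℝ) (k : Fin 3 → ℤ) : ℂ := ∫ x in cube3, (f x : ℂ) * eK (-k) x

/-- The Littlewood–Paley block `Δ_j f` on the torus (`j = -1` uses `χ`, `j ≥ 0` uses `φ̃`). -/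
def LPproj (χ φt : V3 → ℝ) (j : ℤ) (f : V3 → ℝ) (x : V3) : ℂ :=
  ∑' k : Fin 3 → ℤ,
    (((if j = -1 then χ (fun i => (k i : ℝ))
        else if 0 ≤ j then φt (((2:ℝ) ^ (-j)) • (fun i => (k i : ℝ)))
        else 0) : ℝ) : ℂ) * (fc f k * eK k x)

/-- The quantity `2^{j/3} ‖Δ_j f‖_{L^r(T³)}` entering the Besov norm `B^{1/3}_{r,∞}`. -/
def besovPiece (χ φt : V3 → ℝ) (r : ℝ≥0∞) (f : V3 → ℝ) (j : ℤ) : ℝ≥0∞ :=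
  ENNReal.ofReal ((2:ℝ) ^ ((j : ℝ) / 3)) * eLpNorm (LPproj χ φt j f) r muT

/-- The zero-mean inverse Laplacian `Δ⁻¹` on the torus, via Fourier multipliers
`-1/(4π²|k|²)` on the nonzero frequencies. -/
def invLap (f : V3 → ℝ) (x : V3) : ℝ :=
  (∑' k : Fin 3 → ℤ, (if k = 0 then 0 else
      (-1 / (4 * (Real.pi : ℂ)^2 * (((∑ i, ((k i : ℝ))^2) : ℝ) : ℂ))) * (fc f k * eK k x))).re

/-- `(-Δ)⁻¹ = -Δ⁻¹` on zero-mean functions. -/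
def nInv (f : V3 → ℝ) : V3 → ℝ := fun x => -(invLap f x)

/-- The inverse-divergence operator
`R u = -(-Δ)⁻¹(∇u + (∇u)ᵀ) - ½(-Δ)⁻²∇²(∇·u) + ½(-Δ)⁻¹(∇·u) Id`. -/
def RopR (u : V3 → V3) (x : V3) (i j : Fin 3) : ℝ :=
  -(nInv (fun y => pd (fun z => u z i) j y + pd (fun z => u z j) i y) x)
  - (1/2) * nInv (nInv (fun y => pd (fun z => pd (fun w => divg u w) j z) i y)) x
  + (1/2) * (if i = j then nInv (fun y => divg u y) x else 0)

/-- The inverse-divergence operator for scalars: `R_vex f = ∇Δ⁻¹(f - ⨍f)`. -/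
def Rvex (f : V3 → ℝ) (x : V3) (i : Fin 3) : ℝ :=
  pd (invLap (fun z => f z - ∫ w in cube3, f w)) i x

/-- The derivative of the phase of `eK k`. -/
def phaseDeriv (k : Fin 3 → ℤ) : V3 →L[ℝ] ℂ :=
  ∑ i, (2 * (Real.pi : ℂ) * Complex.I * (k i : ℂ)) •
    (Complex.ofRealCLM.comp (ContinuousLinearMap.proj (R := ℝ) (φ := fun _ : Fin 3 => ℝ) i))

lemma phaseDeriv_single (k : Fin 3 → ℤ) (j : Fin 3) :
    phaseDeriv k (Pi.single j 1) = 2 * (Real.pi : ℂ) * Complex.I * (k j : ℂ) := by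
  simp [phaseDeriv, Pi.single_apply, apply_ite (Complex.ofReal)]

lemma eK_eq_exp (k : Fin 3 → ℤ) : eK k = fun x => Complex.exp (phaseDeriv k x) := by
  funext y
  simp [phaseDeriv, eK, Finset.mul_sum, mul_assoc]

lemma hasFDerivAt_eK (k : Fin 3 → ℤ) (x : V3) :
    HasFDerivAt (eK k) (eK k x • phaseDeriv k) x := by
  simp only [eK_eq_exp]
  exact (phaseDeriv k).hasFDerivAt.cexp

lemma contDiff_eK (k : Fin 3 → ℤ) {n : WithTop ℕ∞} : ContDiff ℝ n (eK k) := by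
  rw [eK_eq_exp]
  exact (phaseDeriv k).contDiff.cexp

lemma norm_eK (k : Fin 3 → ℤ) (x : V3) : ‖eK k x‖ = 1 := by
  rw [eK, Complex.norm_exp]
  have : (2 * (Real.pi : ℂ) * Complex.I * (∑ i, (k i : ℂ) * (x i : ℂ))) =
      ((2 * Real.pi * ∑ i, (k i : ℝ) * x i : ℝ) : ℂ) * Complex.I := by
    push_cast; ring
  rw [this, Complex.re_ofReal_mul]
  simp

lemma per_eK (k : Fin 3 → ℤ) : Per (eK k) := by
  intro x m
  have : (2 * (Real.pi : ℂ) * Complex.I * (∑ i, (k i : ℂ) * ((x + fun i => (m i : ℝ)) i : ℂ))) =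
      2 * (Real.pi : ℂ) * Complex.I * (∑ i, (k i : ℂ) * (x i : ℂ)) +
        ((∑ i, k i * m i : ℤ) : ℂ) * (2 * Real.pi * Complex.I) := by
    simp only [Pi.add_apply, Complex.ofReal_add, mul_add, Finset.sum_add_distrib]
    push_cast
    ring
  rw [eK, this, Complex.exp_add, Complex.exp_int_mul_two_pi_mul_I, mul_one, eK]

lemma cube3_ae_eq_Icc : cube3 =ᵐ[volume] Icc (0 : V3) 1 :=
  Measure.univ_pi_Ico_ae_eq_Icc (f := fun _ => (0 : ℝ)) (g := fun _ => 1)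

lemma integrableOn_cube3 {E : Type*} [NormedAddCommGroup E] {g : V3 → E} (hg : Continuous g) :
    IntegrableOn g cube3 :=
  (hg.continuousOn.integrableOn_compact isCompact_Icc).congr_set_ae cube3_ae_eq_Icc

lemma volume_cube3 : volume cube3 = 1 := by
  rw [measure_congr cube3_ae_eq_Icc, Real.volume_Icc_pi]
  simp

lemma setIntegral_fderiv_eq_zero {E : Type*} [NormedAddCommGroup E] [NormedSpace ℝ E]
    {g : V3 → E} (hg : ContDiff ℝ 1 g) (hp : Per g) (j : Fin 3) :
    ∫ x in cube3, fderiv ℝ g x (Pi.single j 1) = 0 := by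
  have hd : Differentiable ℝ g := hg.differentiable one_ne_zero
  have hc : Continuous fun x => fderiv ℝ g x (Pi.single j 1) :=
    (hg.continuous_fderiv one_ne_zero).clm_apply continuous_const
  have hs : ∀ x : V3, ∑ i : Fin 3, (if i = j then fderiv ℝ g x else 0) (Pi.single i 1) =
      fderiv ℝ g x (Pi.single j 1) := by
    intro x
    rw [Finset.sum_eq_single j] <;> simp +contextual
  have key := integral_divergence_of_hasFDerivAt_off_countable' (0 : V3) 1 (fun _ => zero_le_one)
    (fun i x => if i = j then g x else 0) (fun i x => if i = j then fderiv ℝ g x else 0) ∅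
    countable_empty
    (fun i => by
      split_ifs
      · exact hg.continuous.continuousOn
      · exact continuousOn_const)
    (fun x _ i => by
      split_ifs
      · exact (hd x).hasFDerivAt
      · exact hasFDerivAt_const _ _)
    (by
      simp only [hs]
      exact hc.continuousOn.integrableOn_compact isCompact_Icc)
  simp only [hs] at key
  rw [setIntegral_congr_set cube3_ae_eq_Icc, key]
  refine Finset.sum_eq_zero fun i _ => sub_eq_zero.2 ?_
  refine setIntegral_congr_fun measurableSet_Icc fun x _ => ?_
  have : i.insertNth (1 : ℝ) x = i.insertNth (0 : ℝ) x +
      (fun l => (((Pi.single i 1 : Fin 3 → ℤ) l : ℤ) : ℝ)) := by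
    funext l
    refine Fin.succAboveCases i ?_ (fun m => ?_) l <;> simp
  simp only [Pi.one_apply, Pi.zero_apply]
  split_ifs
  · rw [this, hp]
  · rfl

/-- Smooth `ℤ³`-periodic scalar functions. -/
def SmoothPer (f : V3 → ℝ) : Prop := ContDiff ℝ (⊤ : ℕ∞) f ∧ Per f

namespace SmoothPer

variable {f g : V3 → ℝ}

lemma differentiable (hf : SmoothPer f) : Differentiable ℝ f :=
  hf.1.differentiable (by simp)

lemma continuous (hf : SmoothPer f) : Continuous f := hf.1.continuous

lemma add (hf : SmoothPer f) (hg : SmoothPer g) : SmoothPer fun x => f x + g x :=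
  ⟨hf.1.add hg.1, fun x k => by beta_reduce; rw [hf.2, hg.2]⟩

lemma const_mul (hf : SmoothPer f) (c : ℝ) : SmoothPer fun x => c * f x :=
  ⟨contDiff_const.mul hf.1, fun x k => by beta_reduce; rw [hf.2]⟩

lemma sub_const (hf : SmoothPer f) (c : ℝ) : SmoothPer fun x => f x - c :=
  ⟨hf.1.sub contDiff_const, fun x k => by beta_reduce; rw [hf.2]⟩

lemma sum {ι : Type*} {s : Finset ι} {F : ι → V3 → ℝ} (h : ∀ i ∈ s, SmoothPer (F i)) :
    SmoothPer fun x => ∑ i ∈ s, F i x :=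
  ⟨ContDiff.sum fun i hi => (h i hi).1,
    fun x k => Finset.sum_congr rfl fun i hi => (h i hi).2 x k⟩

lemma pd (hf : SmoothPer f) (i : Fin 3) : SmoothPer (pd f i) := by
  refine ⟨(hf.1.fderiv_right (m := (⊤ : ℕ∞)) (by simp)).clm_apply contDiff_const, fun x k => ?_⟩
  have : (fun y => f (y + fun i => (k i : ℝ))) = f := funext fun y => hf.2 y k
  rw [_root_.pd, _root_.pd, ← fderiv_comp_add_right, this]

lemma integral_pd (hf : SmoothPer f) (i : Fin 3) : ∫ x in cube3, _root_.pd f i x = 0 :=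
  setIntegral_fderiv_eq_zero (hf.1.of_le (by simp)) hf.2 i

end SmoothPer

lemma pd_add {f g : V3 → ℝ} (hf : Differentiable ℝ f) (hg : Differentiable ℝ g) (i : Fin 3) :
    pd (fun x => f x + g x) i = fun x => pd f i x + pd g i x := by
  funext x
  simp only [pd]
  rw [fderiv_fun_add (hf x) (hg x)]
  rfl

lemma pd_const_mul {f : V3 → ℝ} (hf : Differentiable ℝ f) (c : ℝ) (i : Fin 3) :
    pd (fun x => c * f x) i = fun x => c * pd f i x := by
  funext x
  simp only [pd]
  rw [fderiv_const_mul (hf x)]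
  rfl

lemma pd_sub_const (f : V3 → ℝ) (c : ℝ) (i : Fin 3) :
    pd (fun x => f x - c) i = pd f i := by
  funext x
  simp only [pd]
  rw [fderiv_sub_const]

lemma pd_sum {ι : Type*} {s : Finset ι} {F : ι → V3 → ℝ}
    (h : ∀ i ∈ s, Differentiable ℝ (F i)) (j : Fin 3) :
    pd (fun x => ∑ i ∈ s, F i x) j = fun x => ∑ i ∈ s, pd (F i) j x := by
  funext x
  simp only [pd]
  rw [fderiv_fun_sum fun i hi => h i hi x]
  simp

lemma pd_comm {f : V3 → ℝ} (hf : ContDiff ℝ (⊤ : ℕ∞) f) (i j : Fin 3) :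
    pd (pd f i) j = pd (pd f j) i := by
  funext x
  have hs : IsSymmSndFDerivAt ℝ f x := hf.contDiffAt.isSymmSndFDerivAt (by simpa using WithTop.coe_le_coe.2 (le_top (a := (2 : ℕ∞))))
  have hd : DifferentiableAt ℝ (fderiv ℝ f) x :=
    (hf.fderiv_right (m := (⊤ : ℕ∞)) (by simp)).differentiable (by simp) x
  have e : ∀ i j : Fin 3, pd (pd f i) j x =
      fderiv ℝ (fderiv ℝ f) x (Pi.single j 1) (Pi.single i 1) := by
    intro i j
    change fderiv ℝ (fun y => fderiv ℝ f y (Pi.single i 1)) x (Pi.single j 1) = _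
    rw [fderiv_clm_apply hd (differentiableAt_const _)]
    simp
  rw [e, e, hs]

/-- The Laplacian. -/
def lap (f : V3 → ℝ) (x : V3) : ℝ := ∑ i, pd (pd f i) i x

lemma SmoothPer.lap {f : V3 → ℝ} (hf : SmoothPer f) : SmoothPer (lap f) :=
  SmoothPer.sum fun i _ => (hf.pd i).pd i

lemma lap_pd {f : V3 → ℝ} (hf : SmoothPer f) (j : Fin 3) : lap (pd f j) = pd (lap f) j := by
  have : pd (lap f) j = fun x => ∑ i, pd (pd (pd f i) i) j x :=
    pd_sum (fun i _ => ((hf.pd i).pd i).differentiable) j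
  rw [this]
  funext x
  refine Finset.sum_congr rfl fun i _ => ?_
  rw [pd_comm hf.1 j i, pd_comm (hf.pd i).1 j i]

lemma lap_add {f g : V3 → ℝ} (hf : SmoothPer f) (hg : SmoothPer g) :
    lap (fun x => f x + g x) = fun x => lap f x + lap g x := by
  funext x
  simp only [lap, pd_add hf.differentiable hg.differentiable,
    pd_add (hf.pd _).differentiable (hg.pd _).differentiable, Finset.sum_add_distrib]

lemma fc_pd {f : V3 → ℝ} (hf : SmoothPer f) (j : Fin 3) (k : Fin 3 → ℤ) :
    fc (pd f j) k = 2 * (Real.pi : ℂ) * Complex.I * (k j : ℂ) * fc f k := by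
  have hfC : ContDiff ℝ 1 fun x => (f x : ℂ) :=
    Complex.ofRealCLM.contDiff.comp (hf.1.of_le (by simp))
  have h := setIntegral_fderiv_eq_zero (g := fun x => (f x : ℂ) * eK (-k) x)
    (hfC.mul (contDiff_eK _)) (fun x m => by beta_reduce; rw [hf.2, per_eK]) j
  have e : ∀ x, fderiv ℝ (fun x => (f x : ℂ) * eK (-k) x) x (Pi.single j 1) =
      (pd f j x : ℂ) * eK (-k) x -
        2 * (Real.pi : ℂ) * Complex.I * (k j : ℂ) * ((f x : ℂ) * eK (-k) x) := by
    intro x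
    have h1 : HasFDerivAt (fun x => (f x : ℂ)) (Complex.ofRealCLM.comp (fderiv ℝ f x)) x :=
      Complex.ofRealCLM.hasFDerivAt.comp x (hf.differentiable x).hasFDerivAt
    rw [(h1.fun_mul (hasFDerivAt_eK (-k) x)).fderiv]
    simp [phaseDeriv_single, pd]
    ring
  simp only [e] at h
  rw [integral_sub, integral_const_mul] at h
  · exact sub_eq_zero.1 h
  · exact integrableOn_cube3 ((Complex.continuous_ofReal.comp (hf.pd j).continuous).mul
      (contDiff_eK (n := 0) _).continuous)
  · exact (integrableOn_cube3 ((Complex.continuous_ofReal.comp hf.continuous).mul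
      (contDiff_eK (n := 0) _).continuous)).const_mul _

lemma eK_zero (x : V3) : eK 0 x = 1 := by simp [eK]

lemma fc_zero (f : V3 → ℝ) : fc f 0 = ((∫ x in cube3, f x : ℝ) : ℂ) := by
  simp only [fc, neg_zero, eK_zero, mul_one]
  exact integral_ofReal

lemma integrableOn_mul_eK {f : V3 → ℝ} (hf : Continuous f) (k : Fin 3 → ℤ) :
    IntegrableOn (fun x => (f x : ℂ) * eK k x) cube3 :=
  integrableOn_cube3 ((Complex.continuous_ofReal.comp hf).mul
    (contDiff_eK (n := 0) _).continuous)

lemma fc_add {f g : V3 → ℝ} (hf : Continuous f) (hg : Continuous g) (k : Fin 3 → ℤ) :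
    fc (fun x => f x + g x) k = fc f k + fc g k := by
  simp only [fc]
  rw [← integral_add (integrableOn_mul_eK hf _) (integrableOn_mul_eK hg _)]
  simp only [Complex.ofReal_add, add_mul]

lemma fc_const_mul (f : V3 → ℝ) (c : ℝ) (k : Fin 3 → ℤ) :
    fc (fun x => c * f x) k = c * fc f k := by
  simp only [fc]
  rw [← integral_const_mul]
  simp only [Complex.ofReal_mul, mul_assoc]

lemma fc_sum {ι : Type*} {s : Finset ι} {F : ι → V3 → ℝ} (h : ∀ i ∈ s, Continuous (F i))
    (k : Fin 3 → ℤ) : fc (fun x => ∑ i ∈ s, F i x) k = ∑ i ∈ s, fc (F i) k := by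
  simp only [fc]
  rw [← integral_finsetSum _ fun i hi => integrableOn_mul_eK (h i hi) _]
  simp only [Complex.ofReal_sum, Finset.sum_mul]

/-- The symbol `4π²|k|²` of `-Δ`. -/
def lapSymbol (k : Fin 3 → ℤ) : ℝ := 4 * Real.pi ^ 2 * ∑ i, (k i : ℝ) ^ 2

lemma lapSymbol_nonneg (k : Fin 3 → ℤ) : 0 ≤ lapSymbol k := by
  unfold lapSymbol; positivity

lemma sq_le_lapSymbol (k : Fin 3 → ℤ) : ∑ i, (k i : ℝ) ^ 2 ≤ lapSymbol k := by
  have h : (1 : ℝ) ≤ 4 * Real.pi ^ 2 := by nlinarith [Real.pi_gt_three]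
  exact le_mul_of_one_le_left (by positivity) h

lemma one_le_lapSymbol {k : Fin 3 → ℤ} (hk : k ≠ 0) : 1 ≤ lapSymbol k := by
  obtain ⟨i, hi⟩ := Function.ne_iff.1 hk
  refine le_trans ?_ (sq_le_lapSymbol k)
  refine le_trans ?_ (Finset.single_le_sum (fun j _ => sq_nonneg (k j : ℝ)) (Finset.mem_univ i))
  have : 1 ≤ (k i) ^ 2 := Int.add_one_le_of_lt (sq_pos_of_ne_zero hi)
  exact_mod_cast this

lemma fc_lap {f : V3 → ℝ} (hf : SmoothPer f) (k : Fin 3 → ℤ) :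
    fc (lap f) k = -(lapSymbol k : ℂ) * fc f k := by
  have : fc (lap f) k = ∑ i, fc (pd (pd f i) i) k :=
    fc_sum (fun i _ => ((hf.pd i).pd i).continuous) k
  rw [this]
  simp only [fc_pd (hf.pd _), fc_pd hf, lapSymbol, Fin.sum_univ_three]
  push_cast
  linear_combination (4 * (Real.pi : ℂ) ^ 2 * ((k 0 : ℂ) ^ 2 + (k 1 : ℂ) ^ 2 + (k 2 : ℂ) ^ 2) *
    fc f k) * Complex.I_sq

/-- The symbol `1 + 4π²|k|²` of `1 - Δ`. -/
def bessel (k : Fin 3 → ℤ) : ℝ := 1 + lapSymbol k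

lemma one_le_bessel (k : Fin 3 → ℤ) : 1 ≤ bessel k :=
  le_add_of_nonneg_right (lapSymbol_nonneg k)

lemma fc_decay (n : ℕ) : ∀ {f : V3 → ℝ}, SmoothPer f →
    ∃ C, ∀ k, bessel k ^ n * ‖fc f k‖ ≤ C := by
  induction n with
  | zero =>
    intro f hf
    refine ⟨∫ x in cube3, ‖f x‖, fun k => ?_⟩
    rw [pow_zero, one_mul]
    refine (norm_integral_le_integral_norm _).trans_eq ?_
    simp only [norm_mul, norm_eK, mul_one, Complex.norm_real]
  | succ n ih =>
    intro f hf
    obtain ⟨C, hC⟩ := ih (hf.add (hf.lap.const_mul (-1)))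
    refine ⟨C, fun k => (le_of_eq ?_).trans (hC k)⟩
    rw [fc_add hf.continuous (hf.lap.const_mul _).continuous, fc_const_mul, fc_lap hf]
    have : fc f k + ((-1 : ℝ) : ℂ) * (-(lapSymbol k : ℂ) * fc f k) = (bessel k : ℂ) * fc f k := by
      simp only [bessel]; push_cast; ring
    rw [this, norm_mul, Complex.norm_real, Real.norm_of_nonneg (by linarith [one_le_bessel k])]
    ring

lemma summable_int_inv_one_add_sq : Summable fun n : ℤ => (1 + (n : ℝ) ^ 2)⁻¹ := by
  refine Summable.of_norm_bounded_eventually (g := fun n : ℤ => 1 / (n : ℝ) ^ 2)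
    (Real.summable_one_div_int_pow.2 one_lt_two) ?_
  rw [Filter.eventually_cofinite]
  refine (Set.finite_singleton (0 : ℤ)).subset fun n hn => ?_
  by_contra h
  refine hn ?_
  have h0 : (0 : ℝ) < (n : ℝ) ^ 2 := by
    have : (n : ℝ) ≠ 0 := by exact_mod_cast h
    positivity
  rw [Real.norm_of_nonneg (by positivity), one_div]
  exact inv_anti₀ h0 (by linarith)

lemma summable_bessel : Summable fun k => (bessel k ^ 3)⁻¹ := by
  have h := summable_int_inv_one_add_sq
  have hn : 0 ≤ fun n : ℤ => (1 + (n : ℝ) ^ 2)⁻¹ := fun n => by positivity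
  have h2 := h.mul_of_nonneg h hn hn
  have h3 := h.mul_of_nonneg h2 hn (fun p => by positivity)
  have hinj : Function.Injective fun k : Fin 3 → ℤ => (k 0, k 1, k 2) := by
    intro a b hab
    simp only [Prod.mk.injEq] at hab
    funext i
    fin_cases i
    exacts [hab.1, hab.2.1, hab.2.2]
  refine (h3.comp_injective hinj).of_nonneg_of_le
    (fun k => inv_nonneg.2 (pow_nonneg (by linarith [one_le_bessel k]) 3)) fun k => ?_
  have hs := sq_le_lapSymbol k
  rw [Fin.sum_univ_three] at hs
  have hb : ∀ i, 1 + (k i : ℝ) ^ 2 ≤ bessel k := by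
    intro i
    have : (k i : ℝ) ^ 2 ≤ _ :=
      (Finset.single_le_sum (fun j _ => sq_nonneg (k j : ℝ)) (Finset.mem_univ i))
    have := this.trans (sq_le_lapSymbol k)
    unfold bessel; linarith
  simp only [Function.comp_apply]
  rw [← mul_inv, ← mul_inv]
  refine inv_anti₀ (by positivity) ?_
  calc (1 + (k 0 : ℝ) ^ 2) * ((1 + (k 1 : ℝ) ^ 2) * (1 + (k 2 : ℝ) ^ 2))
      ≤ bessel k * (bessel k * bessel k) := by
        have := one_le_bessel k
        gcongr <;> exact hb _
    _ = bessel k ^ 3 := by ring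

/-- Coefficients decaying faster than any polynomial. -/
def Rapid (c : (Fin 3 → ℤ) → ℂ) : Prop := ∀ n : ℕ, Summable fun k => bessel k ^ n * ‖c k‖

lemma rapid_fc {f : V3 → ℝ} (hf : SmoothPer f) : Rapid (fc f) := by
  intro n
  obtain ⟨C, hC⟩ := fc_decay (n + 3) hf
  have hp : ∀ k, 0 < bessel k := fun k => by linarith [one_le_bessel k]
  refine (summable_bessel.mul_left C).of_nonneg_of_le
    (fun k => mul_nonneg (pow_nonneg (hp k).le _) (norm_nonneg _)) fun k => ?_
  rw [← div_eq_mul_inv, le_div_iff₀ (pow_pos (hp k) 3)]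
  refine (le_of_eq ?_).trans (hC k)
  ring

namespace Rapid

variable {c : (Fin 3 → ℤ) → ℂ}

lemma mul (hc : Rapid c) {m : (Fin 3 → ℤ) → ℂ} {A : ℝ} (hm : ∀ k, ‖m k‖ ≤ A * bessel k) :
    Rapid fun k => m k * c k := by
  intro n
  have hp : ∀ k, 0 < bessel k := fun k => by linarith [one_le_bessel k]
  refine ((hc (n + 1)).mul_left A).of_nonneg_of_le
    (fun k => mul_nonneg (pow_nonneg (hp k).le _) (norm_nonneg _)) fun k => ?_
  rw [norm_mul]
  calc bessel k ^ n * (‖m k‖ * ‖c k‖) ≤ bessel k ^ n * ((A * bessel k) * ‖c k‖) := by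
        have := (hp k).le
        gcongr
        exact hm k
    _ = _ := by ring

lemma summable_norm (hc : Rapid c) : Summable fun k => ‖c k‖ := by
  simpa using hc 0

lemma summable_mul_eK (hc : Rapid c) (x : V3) : Summable fun k => c k * eK k x := by
  refine Summable.of_norm ?_
  simpa only [norm_mul, norm_eK, mul_one] using hc.summable_norm

end Rapid

lemma norm_phaseDeriv_apply_le (k : Fin 3 → ℤ) (v : V3) :
    ‖phaseDeriv k v‖ ≤ 3 * bessel k * ‖v‖ := by
  have h : ∀ i, ‖2 * (Real.pi : ℂ) * Complex.I * (k i : ℂ) * (v i : ℂ)‖ ≤ bessel k * ‖v‖ := by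
    intro i
    rw [norm_mul, Complex.norm_real]
    refine mul_le_mul ?_ (norm_le_pi_norm v i) (norm_nonneg _) (by linarith [one_le_bessel k])
    have e : ‖2 * (Real.pi : ℂ) * Complex.I * (k i : ℂ)‖ = 2 * Real.pi * |(k i : ℝ)| := by
      simp [abs_of_pos Real.pi_pos]
    have h1 : (k i : ℝ) ^ 2 ≤ ∑ i, (k i : ℝ) ^ 2 :=
      Finset.single_le_sum (fun j _ => sq_nonneg (k j : ℝ)) (Finset.mem_univ i)
    have h2 : 4 * Real.pi ^ 2 * (k i : ℝ) ^ 2 ≤ lapSymbol k :=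
      mul_le_mul_of_nonneg_left h1 (by positivity)
    rw [e, bessel]
    nlinarith [sq_nonneg (2 * Real.pi * |(k i : ℝ)| - 1), sq_abs (k i : ℝ)]
  have e : phaseDeriv k v = ∑ i, 2 * (Real.pi : ℂ) * Complex.I * (k i : ℂ) * (v i : ℂ) := by
    simp [phaseDeriv]
  rw [e]
  refine (norm_sum_le_of_le _ fun i _ => h i).trans_eq ?_
  simp [mul_assoc]

/-- The trigonometric series with coefficients `c`. -/
def fourierSum (c : (Fin 3 → ℤ) → ℂ) (x : V3) : ℂ := ∑' k, c k * eK k x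

namespace Rapid

variable {c : (Fin 3 → ℤ) → ℂ}

lemma phase (hc : Rapid c) (v : V3) : Rapid fun k => phaseDeriv k v * c k :=
  hc.mul (A := 3 * ‖v‖) fun k => (norm_phaseDeriv_apply_le k v).trans_eq (by ring)

lemma norm_term_le (x : V3) (k : Fin 3 → ℤ) :
    ‖c k • eK k x • phaseDeriv k‖ ≤ 3 * (bessel k ^ 1 * ‖c k‖) := by
  rw [norm_smul, norm_smul, norm_eK, one_mul]
  have : ‖phaseDeriv k‖ ≤ 3 * bessel k :=
    ContinuousLinearMap.opNorm_le_bound _ (by linarith [one_le_bessel k])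
      (norm_phaseDeriv_apply_le k)
  nlinarith [norm_nonneg (c k)]

lemma hasFDerivAt (hc : Rapid c) (x : V3) :
    HasFDerivAt (fourierSum c) (∑' k, c k • eK k x • phaseDeriv k) x :=
  hasFDerivAt_tsum ((hc 1).mul_left 3) (fun k x => (hasFDerivAt_eK k x).const_mul (c k))
    (fun k x => norm_term_le x k) (hc.summable_mul_eK 0) x

lemma fderiv_apply (hc : Rapid c) (x v : V3) :
    fderiv ℝ (fourierSum c) x v = fourierSum (fun k => phaseDeriv k v * c k) x := by
  have hs : Summable fun k => c k • eK k x • phaseDeriv k :=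
    Summable.of_norm_bounded ((hc 1).mul_left 3) fun k => norm_term_le x k
  rw [(hc.hasFDerivAt x).fderiv]
  have := (ContinuousLinearMap.apply ℝ ℂ v).map_tsum hs
  simp only [ContinuousLinearMap.apply_apply] at this
  rw [this, fourierSum]
  refine tsum_congr fun k => ?_
  simp only [smul_apply, smul_eq_mul]
  ring

lemma contDiff_nat (n : ℕ) : ∀ {c : (Fin 3 → ℤ) → ℂ}, Rapid c →
    ContDiff ℝ n (fourierSum c) := by
  induction n with
  | zero =>
    intro c hc
    exact contDiff_zero.2
      (continuous_iff_continuousAt.2 fun x => (hc.hasFDerivAt x).continuousAt)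
  | succ n ih =>
    intro c hc
    push_cast
    rw [contDiff_succ_iff_fderiv_apply]
    refine ⟨fun x => (hc.hasFDerivAt x).differentiableAt, by simp, fun v => ?_⟩
    simp only [hc.fderiv_apply]
    exact ih (hc.phase v)

lemma contDiff (hc : Rapid c) : ContDiff ℝ (⊤ : ℕ∞) (fourierSum c) :=
  contDiff_infty.2 fun n => contDiff_nat n hc

lemma smoothPer_re (hc : Rapid c) : SmoothPer fun x => (fourierSum c x).re := by
  refine ⟨Complex.reCLM.contDiff.comp hc.contDiff, fun x k => ?_⟩
  simp only [fourierSum, per_eK _ x k]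

lemma pd_re (hc : Rapid c) (j : Fin 3) :
    pd (fun x => (fourierSum c x).re) j =
      fun x => (fourierSum (fun k => phaseDeriv k (Pi.single j 1) * c k) x).re := by
  funext x
  have h : HasFDerivAt (fun x => (fourierSum c x).re)
      (Complex.reCLM.comp (fderiv ℝ (fourierSum c) x)) x :=
    Complex.reCLM.hasFDerivAt.comp x (hc.hasFDerivAt x).differentiableAt.hasFDerivAt
  rw [pd, h.fderiv, ← hc.fderiv_apply]
  rfl

end Rapid

lemma mFourier_coe (k : Fin 3 → ℤ) (x : V3) :
    UnitAddTorus.mFourier k (fun i => (x i : UnitAddCircle)) = eK k x := by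
  simp only [UnitAddTorus.mFourier, ContinuousMap.coe_mk, fourier_coe_apply, eK]
  rw [← Complex.exp_sum, Finset.mul_sum]
  congr 1
  refine Finset.sum_congr rfl fun i _ => ?_
  simp only [Complex.ofReal_one, div_one]
  ring

lemma cube3_ae_eq_Ioc :
    cube3 =ᵐ[volume] {x : V3 | ∀ i, x i ∈ Ioc ((0 : V3) i) ((0 : V3) i + 1)} := by
  have h : {x : V3 | ∀ i, x i ∈ Ioc ((0 : V3) i) ((0 : V3) i + 1)} =
      Set.univ.pi fun _ => Ioc (0 : ℝ) 1 := by
    ext x; simp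
  rw [h]
  exact cube3_ae_eq_Icc.trans
    (Measure.univ_pi_Ioc_ae_eq_Icc (f := fun _ => (0 : ℝ)) (g := fun _ => 1)).symm

lemma exists_torus_lift {f : V3 → ℝ} (hf : Continuous f) (hp : Per f) :
    ∃ F : C(UnitAddTorus (Fin 3), ℂ), ∀ x : V3, F (fun i => (x i : UnitAddCircle)) = f x := by
  have hq : IsOpenQuotientMap
      (Pi.map fun (_ : Fin 3) (t : ℝ) => (t : UnitAddCircle)) :=
    IsOpenQuotientMap.piMap fun _ => QuotientAddGroup.isOpenQuotientMap_mk
  let q : C(V3, UnitAddTorus (Fin 3)) := ⟨_, hq.continuous⟩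
  let g : C(V3, ℂ) := ⟨fun x => (f x : ℂ), Complex.continuous_ofReal.comp hf⟩
  have hfac : Function.FactorsThrough g q := by
    intro a b hab
    have h : ∀ i, ∃ n : ℤ, (n : ℝ) = -a i + b i := by
      intro i
      have := QuotientAddGroup.eq.1 (congrFun hab i)
      simpa [AddSubgroup.mem_zmultiples_iff] using this
    choose n hn using h
    have : b = a + fun i => (n i : ℝ) := by
      funext i
      simp [hn]
    change (f a : ℂ) = f b
    rw [this, hp]
  have hq' : Topology.IsQuotientMap q := hq.isQuotientMap
  refine ⟨hq'.lift g hfac, fun x => ?_⟩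
  exact DFunLike.congr_fun (hq'.lift_comp g hfac) x

lemma hasSum_fourier {f : V3 → ℝ} (hf : SmoothPer f) (x : V3) :
    HasSum (fun k => fc f k * eK k x) (f x : ℂ) := by
  obtain ⟨F, hF⟩ := exists_torus_lift hf.continuous hf.2
  have hc : UnitAddTorus.mFourierCoeff F = fc f := by
    funext k
    rw [UnitAddTorus.mFourierCoeff_eq_integral F k 0, fc,
      ← setIntegral_congr_set cube3_ae_eq_Ioc]
    simp only [mFourier_coe, hF, smul_eq_mul, mul_comm]
  have hs : Summable (UnitAddTorus.mFourierCoeff F) := by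
    rw [hc]
    exact (rapid_fc hf).summable_norm.of_norm
  have := UnitAddTorus.hasSum_mFourier_series_apply_of_summable hs fun i => (x i : UnitAddCircle)
  simpa only [hc, mFourier_coe, hF, smul_eq_mul] using this

lemma re_tsum_ne_zero {f : V3 → ℝ} (hf : SmoothPer f) (x : V3) :
    (∑' k, if k = 0 then 0 else fc f k * eK k x).re = f x - ∫ z in cube3, f z := by
  have h := hasSum_fourier hf x
  have h2 := h.summable.tsum_eq_add_tsum_ite 0
  rw [h.tsum_eq, eK_zero, mul_one, fc_zero] at h2
  rw [eq_sub_iff_add_eq', ← Complex.ofReal_re (f x), h2, Complex.add_re, Complex.ofReal_re]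

/-- The Fourier multiplier of `invLap`. -/
def invLapSymbol (k : Fin 3 → ℤ) : ℂ :=
  if k = 0 then 0 else -1 / (4 * (Real.pi : ℂ) ^ 2 * (((∑ i, ((k i : ℝ)) ^ 2) : ℝ) : ℂ))

lemma invLapSymbol_of_ne {k : Fin 3 → ℤ} (hk : k ≠ 0) :
    invLapSymbol k = -1 / (lapSymbol k : ℂ) := by
  rw [invLapSymbol, if_neg hk, lapSymbol]
  push_cast
  rfl

lemma rapid_invLap {f : V3 → ℝ} (hf : SmoothPer f) : Rapid fun k => invLapSymbol k * fc f k := by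
  refine (rapid_fc hf).mul (A := 1) fun k => ?_
  rw [one_mul]
  refine le_trans ?_ (one_le_bessel k)
  rcases eq_or_ne k 0 with rfl | hk
  · simp [invLapSymbol]
  · rw [invLapSymbol_of_ne hk, norm_div, norm_neg, norm_one, Complex.norm_real,
      Real.norm_of_nonneg (lapSymbol_nonneg k)]
    exact div_le_one_of_le₀ (one_le_lapSymbol hk) (lapSymbol_nonneg k)

lemma invLap_eq (f : V3 → ℝ) :
    invLap f = fun x => (fourierSum (fun k => invLapSymbol k * fc f k) x).re := by
  funext x
  rw [invLap, fourierSum]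
  congr 2
  funext k
  rw [invLapSymbol]
  split_ifs <;> ring

lemma SmoothPer.invLap {f : V3 → ℝ} (hf : SmoothPer f) : SmoothPer (invLap f) := by
  rw [invLap_eq]
  exact (rapid_invLap hf).smoothPer_re

lemma lap_invLap {f : V3 → ℝ} (hf : SmoothPer f) :
    lap (invLap f) = fun x => f x - ∫ z in cube3, f z := by
  funext x
  have hr := rapid_invLap hf
  rw [← re_tsum_ne_zero hf x, invLap_eq, lap]
  simp only [hr.pd_re, (hr.phase _).pd_re]
  rw [← Complex.re_sum]
  simp only [fourierSum]
  rw [← Summable.tsum_finsetSum fun i _ => ((hr.phase _).phase _).summable_mul_eK x]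
  congr 2
  funext k
  rcases eq_or_ne k 0 with rfl | hk
  · simp [invLapSymbol]
  · have h0 : (lapSymbol k : ℂ) ≠ 0 := by
      have := one_le_lapSymbol hk
      exact_mod_cast (by linarith : lapSymbol k ≠ 0)
    have hs : ∑ i, phaseDeriv k (Pi.single i 1) ^ 2 = -(lapSymbol k : ℂ) := by
      simp only [phaseDeriv_single, lapSymbol, Fin.sum_univ_three]
      push_cast
      linear_combination (4 * (Real.pi : ℂ) ^ 2 *
        ((k 0 : ℂ) ^ 2 + (k 1 : ℂ) ^ 2 + (k 2 : ℂ) ^ 2)) * Complex.I_sq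
    rw [if_neg hk, invLapSymbol_of_ne hk]
    calc _ = (∑ i, phaseDeriv k (Pi.single i 1) ^ 2) *
            (-1 / (lapSymbol k : ℂ) * fc f k * eK k x) := by
          rw [Finset.sum_mul]
          exact Finset.sum_congr rfl fun i _ => by ring
      _ = fc f k * eK k x := by
          rw [hs]
          field_simp

lemma invLap_lap {f : V3 → ℝ} (hf : SmoothPer f) :
    invLap (lap f) = fun x => f x - ∫ z in cube3, f z := by
  funext x
  rw [← re_tsum_ne_zero hf x, invLap]
  congr 2
  funext k
  split_ifs with hk
  · rfl
  · have h0 : (lapSymbol k : ℂ) ≠ 0 := by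
      have := one_le_lapSymbol hk
      exact_mod_cast (by linarith : lapSymbol k ≠ 0)
    have h1 := invLapSymbol_of_ne hk
    rw [invLapSymbol, if_neg hk] at h1
    rw [h1, fc_lap hf]
    field_simp

lemma invLap_pd {f : V3 → ℝ} (hf : SmoothPer f) (j : Fin 3) :
    invLap (pd f j) = pd (invLap f) j := by
  have h : pd f j = lap (pd (invLap f) j) := by
    rw [lap_pd hf.invLap, lap_invLap hf, pd_sub_const]
  rw [h, invLap_lap (hf.invLap.pd j), hf.invLap.integral_pd]
  simp only [sub_zero]

lemma invLap_add_pd {f g : V3 → ℝ} (hf : SmoothPer f) (hg : SmoothPer g) (i j : Fin 3) :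
    invLap (fun x => pd f i x + pd g j x) =
      fun x => pd (invLap f) i x + pd (invLap g) j x := by
  have hF := hf.invLap.pd i
  have hG := hg.invLap.pd j
  have h : (fun x => pd f i x + pd g j x) =
      lap fun x => pd (invLap f) i x + pd (invLap g) j x := by
    rw [lap_add hF hG, lap_pd hf.invLap, lap_invLap hf, pd_sub_const, lap_pd hg.invLap,
      lap_invLap hg, pd_sub_const]
  rw [h, invLap_lap (hF.add hG), integral_add (integrableOn_cube3 hF.continuous)
    (integrableOn_cube3 hG.continuous), hf.invLap.integral_pd, hg.invLap.integral_pd]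
  simp only [add_zero, sub_zero]

lemma invLap_neg (f : V3 → ℝ) : invLap (fun x => -f x) = fun x => -invLap f x := by
  have h : ∀ k, fc (fun x => -f x) k = -fc f k := fun k => by
    simpa using fc_const_mul f (-1) k
  funext x
  simp only [invLap, h]
  rw [← Complex.neg_re, ← tsum_neg]
  congr 2
  funext k
  split_ifs <;> ring

lemma integral_sub_mean {f : V3 → ℝ} (hf : Continuous f) :
    ∫ x in cube3, (f x - ∫ z in cube3, f z) = 0 := by
  have : IsProbabilityMeasure (volume.restrict cube3) := ⟨by simp [volume_cube3]⟩
  rw [integral_sub (integrableOn_cube3 hf) (integrable_const _)]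
  simp

lemma lap_invLap_of_integral_eq_zero {f : V3 → ℝ} (hf : SmoothPer f)
    (h0 : ∫ x in cube3, f x = 0) : lap (invLap f) = f := by
  rw [lap_invLap hf, h0]
  simp only [sub_zero]

section Antidivergence

variable {u : V3 → V3}

lemma SmoothPer.coord (hu : ContDiff ℝ (⊤ : ℕ∞) u) (hp : Per u) (i : Fin 3) :
    SmoothPer fun x => u x i :=
  ⟨contDiff_pi.1 hu i, fun x k => congrFun (hp x k) i⟩

lemma smoothPer_divg (hu : ∀ i, SmoothPer fun x => u x i) : SmoothPer (divg u) :=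
  SmoothPer.sum fun i _ => (hu i).pd i

lemma invLap_divg (hu : ∀ i, SmoothPer fun x => u x i) :
    invLap (divg u) = fun x => ∑ i, pd (invLap fun z => u z i) i x := by
  have hs : SmoothPer fun x => ∑ i, pd (invLap fun z => u z i) i x :=
    SmoothPer.sum fun i _ => (hu i).invLap.pd i
  have h : divg u = lap fun x => ∑ i, pd (invLap fun z => u z i) i x := by
    have h1 : ∀ i, pd (fun z => u z i) i = lap (pd (invLap fun z => u z i) i) := fun i => by
      rw [lap_pd (hu i).invLap, lap_invLap (hu i), pd_sub_const]
    funext x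
    have h2 := fun i => ((hu i).invLap.pd i)
    simp only [divg, h1, Fin.sum_univ_three]
    rw [lap_add ((h2 0).add (h2 1)) (h2 2), lap_add (h2 0) (h2 1)]
  rw [h, invLap_lap hs, integral_finsetSum _ fun i _ =>
    integrableOn_cube3 ((hu i).invLap.pd i).continuous]
  simp only [fun i => (hu i).invLap.integral_pd i, Finset.sum_const_zero, sub_zero]

lemma RopR_eq (hu : ∀ i, SmoothPer fun x => u x i) (i j : Fin 3) :
    (fun x => RopR u x i j) = fun x =>
      (pd (invLap fun z => u z i) j x + pd (invLap fun z => u z j) i x)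
      + (-(1 / 2) * pd (pd (invLap (invLap (divg u))) j) i x
      + (-(1 / 2)) * (if i = j then 1 else 0) * invLap (divg u) x) := by
  have hd := smoothPer_divg hu
  funext x
  have h1 : (fun y => pd (fun z => pd (fun w => divg u w) j z) i y) = pd (pd (divg u) j) i := rfl
  have h2 : nInv (pd (pd (divg u) j) i) = fun x => -pd (pd (invLap (divg u)) j) i x := by
    funext x
    rw [nInv, invLap_pd (hd.pd j), invLap_pd hd]
  have h3 : nInv (fun x => -pd (pd (invLap (divg u)) j) i x) =
      pd (pd (invLap (invLap (divg u))) j) i := by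
    funext x
    rw [nInv, invLap_neg, invLap_pd (hd.invLap.pd j), invLap_pd hd.invLap, neg_neg]
  rw [RopR, h1, h2, h3, nInv, invLap_add_pd (hu i) (hu j)]
  simp only [nInv]
  split_ifs <;> ring

lemma lap_invLap_invLap_divg (hu : ∀ i, SmoothPer fun x => u x i) :
    lap (invLap (invLap (divg u))) = invLap (divg u) := by
  refine lap_invLap_of_integral_eq_zero (smoothPer_divg hu).invLap ?_
  rw [invLap_divg hu, integral_finsetSum _ fun i _ =>
    integrableOn_cube3 ((hu i).invLap.pd i).continuous]
  exact Finset.sum_eq_zero fun i _ => (hu i).invLap.integral_pd i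

lemma RopR_symm (hu : ∀ i, SmoothPer fun x => u x i) (x : V3) (i j : Fin 3) :
    RopR u x i j = RopR u x j i := by
  have h := fun i j => congrFun (RopR_eq hu i j) x
  rw [h i j, h j i, pd_comm (smoothPer_divg hu).invLap.invLap.1 j i, add_comm (pd _ j x)]
  simp only [eq_comm]

lemma RopR_trace (hu : ∀ i, SmoothPer fun x => u x i) (x : V3) : ∑ i, RopR u x i i = 0 := by
  have h := fun i j => congrFun (RopR_eq hu i j) x
  have h1 := congrFun (lap_invLap_invLap_divg hu) x
  have h2 := congrFun (invLap_divg hu) x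
  simp only [lap, Fin.sum_univ_three] at h h1 h2 ⊢
  rw [h, h, h]
  simp only [if_true]
  linarith

lemma divg_RopR (hu : ∀ i, SmoothPer fun x => u x i) (x : V3) (i : Fin 3) :
    ∑ j, pd (fun y => RopR u y i j) j x = u x i - ∫ z in cube3, u z i := by
  have hD := (smoothPer_divg hu).invLap
  have hE := hD.invLap
  have hpd : ∀ j, pd (fun y => RopR u y i j) j x =
      (pd (pd (invLap fun z => u z i) j) j x + pd (pd (invLap fun z => u z j) j) i x) +
      (-(1 / 2) * pd (pd (pd (invLap (invLap (divg u))) j) j) i x +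
        (-(1 / 2)) * (if i = j then 1 else 0) * pd (invLap (divg u)) j x) := by
    intro j
    have ha := ((hu i).invLap.pd j)
    have hb := ((hu j).invLap.pd i)
    have hc := (hE.pd j).pd i
    rw [RopR_eq hu, pd_add (ha.add hb).differentiable
      ((hc.const_mul _).add (hD.const_mul _)).differentiable,
      pd_add ha.differentiable hb.differentiable,
      pd_add (hc.const_mul _).differentiable (hD.const_mul _).differentiable,
      pd_const_mul hc.differentiable, pd_const_mul hD.differentiable,
      pd_comm (hu j).invLap.1 i j, pd_comm (hE.pd j).1 i j]
  have h1 := congrFun (lap_invLap (hu i)) x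
  have h2 : pd (invLap (divg u)) i x = ∑ j, pd (pd (invLap fun z => u z j) j) i x := by
    rw [invLap_divg hu, pd_sum fun j _ => ((hu j).invLap.pd j).differentiable]
  have h3 : pd (invLap (divg u)) i x =
      ∑ j, pd (pd (pd (invLap (invLap (divg u))) j) j) i x := by
    rw [← congrFun (pd_sum (fun j _ => ((hE.pd j).pd j).differentiable) i) x]
    exact congrArg (fun f => pd f i x) (lap_invLap_invLap_divg hu).symm
  have h4 : ∑ j, (-(1 / 2) : ℝ) * (if i = j then 1 else 0) * pd (invLap (divg u)) j x =
      -(1 / 2) * pd (invLap (divg u)) i x := by simp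
  rw [Finset.sum_congr rfl fun j _ => hpd j, Finset.sum_add_distrib, Finset.sum_add_distrib,
    Finset.sum_add_distrib, ← Finset.mul_sum, ← h2, ← h3, h4, ← h1, lap]
  ring

end Antidivergence

lemma divg_Rvex {f : V3 → ℝ} (hf : SmoothPer f) (x : V3) :
    ∑ i, pd (fun y => Rvex f y i) i x = f x - ∫ z in cube3, f z :=
  congrFun (lap_invLap_of_integral_eq_zero (hf.sub_const _) (integral_sub_mean hf.continuous)) x

/-- `R u` is symmetric, trace-free, and `div (R u) = u - ⨍ u`;
moreover `div (R_vex f) = f - ⨍ f`. -/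
theorem stmt12 :
    (∀ u : V3 → V3, ContDiff ℝ (⊤ : ℕ∞) u → Per u →
      (∀ (x : V3) (i j : Fin 3), RopR u x i j = RopR u x j i) ∧
      (∀ x : V3, ∑ i, RopR u x i i = 0) ∧
      (∀ (x : V3) (i : Fin 3),
        (∑ j, pd (fun y => RopR u y i j) j x) = u x i - ∫ z in cube3, u z i)) ∧
    (∀ f : V3 → ℝ, ContDiff ℝ (⊤ : ℕ∞) f → Per f →
      ∀ x : V3, (∑ i, pd (fun y => Rvex f y i) i x) = f x - ∫ z in cube3, f z) := by
  refine ⟨fun u hu hp => ?_, fun f hf hp x => divg_Rvex ⟨hf, hp⟩ x⟩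
  have h := SmoothPer.coord hu hp
  exact ⟨RopR_symm h, RopR_trace h, divg_RopR h⟩
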